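/- Fix B>0 and d∈ℕ+. For z∈ℝ^d and j,j'∈ℤ define φ_{d,B}(z;j,j') := −σ(z+4B(j'−j+1/2)·1_d) + 2σ(z+4B(j'−j+1/4)·1_d) − 2σ(z+4B(j'−j−1/4)·1_d) + σ(z+4B(j'−j−1/2)·1_d). Then for every z∈ℝ^d with ‖z‖_max ≤ B and all j,j'∈ℤ, φ_{d,B}(z;j,j') equals z if j=j' and equals the zero vector otherwise. -/

import Mathlib

/-- The ReLU activation function. -/
noncomputable def relu (x : ℝ) : ℝ := max x 0

/-- `φ_{d,B}(z; j, j')`. -/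
noncomputable def phiFn (d : ℕ) (B : ℝ) (z : Fin d → ℝ) (j j' : ℤ) : Fin d → ℝ :=
  fun k =>
    -relu (z k + 4 * B * ((j' : ℝ) - (j : ℝ) + 1 / 2))
      + 2 * relu (z k + 4 * B * ((j' : ℝ) - (j : ℝ) + 1 / 4))
      - 2 * relu (z k + 4 * B * ((j' : ℝ) - (j : ℝ) - 1 / 4))
      + relu (z k + 4 * B * ((j' : ℝ) - (j : ℝ) - 1 / 2))

theorem statement_0 (B : ℝ) (hB : 0 < B) (d : ℕ) (hd : 0 < d)
    (z : Fin d → ℝ) (hz : ∀ k, |z k| ≤ B) (j j' : ℤ) :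
    phiFn d B z j j' = if j = j' then z else 0 := by
  funext k
  obtain ⟨hl, hu⟩ := abs_le.mp (hz k)
  rcases lt_trichotomy j j' with h | rfl | h
  · have hm : (j : ℝ) + 1 ≤ j' := by exact_mod_cast h
    have hBm : 0 ≤ B * ((j' : ℝ) - j - 1) := mul_nonneg hB.le (by linarith)
    rw [if_neg h.ne]
    simp only [phiFn, relu, Pi.zero_apply]
    rw [max_eq_left (by linarith), max_eq_left (by linarith), max_eq_left (by linarith),
      max_eq_left (by linarith)]
    ring
  · rw [if_pos rfl]
    simp only [phiFn, relu, sub_self]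
    rw [max_eq_left (by linarith), max_eq_left (by linarith), max_eq_right (by linarith),
      max_eq_right (by linarith)]
    ring
  · have hm : (j' : ℝ) + 1 ≤ j := by exact_mod_cast h
    have hBm : 0 ≤ B * ((j : ℝ) - j' - 1) := mul_nonneg hB.le (by linarith)
    rw [if_neg h.ne']
    simp only [phiFn, relu, Pi.zero_apply]
    rw [max_eq_right (by linarith), max_eq_right (by linarith), max_eq_right (by linarith),
      max_eq_right (by linarith)]
    ring
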